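/- arXiv:1607.00177 — 5 statements merged into one kernel-verified Lean document; each statement's English description precedes it below -/
import Mathlib

section
/- Let r₀ > 0, r̄ > 0 and γ ≥ 1 be given constants, and define f(γ, r; r₀) := r · ∫_{r₀}^{r} (s^γ − r₀^γ)/s² ds for r > 0. Then there exists a constant C = C(γ, r₀, r̄) ≥ 1 such that (1/C)(r − r₀)² ≤ f(γ, r; r₀) ≤ C (r − r₀)² for all r ∈ (0, r̄]. -/
open MeasureTheory

/-- If `φ` is nonnegative to the right of `a` and nonpositive to its left, then its integral from
`a` is nonnegative. -/
lemma intervalIntegral_nonneg_of_sign {φ : ℝ → ℝ} {a b : ℝ}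
    (hpos : ∀ s ∈ Set.Icc a b, 0 ≤ φ s) (hneg : ∀ s ∈ Set.Icc b a, φ s ≤ 0) :
    0 ≤ ∫ s in a..b, φ s := by
  rcases le_total a b with hab | hab
  · exact intervalIntegral.integral_nonneg hab hpos
  · rw [intervalIntegral.integral_symm, ← intervalIntegral.integral_neg]
    exact intervalIntegral.integral_nonneg hab fun s hs => neg_nonneg.2 (hneg s hs)

/-- The graph of `x ↦ x ^ p`, `p ≥ 1`, lies above its tangent lines. -/
lemma rpow_add_mul_sub_le_rpow {x y p : ℝ} (hx : 0 < x) (hy : 0 < y) (hp : 1 ≤ p) :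
    x ^ p + p * x ^ (p - 1) * (y - x) ≤ y ^ p := by
  have h := one_add_mul_self_le_rpow_one_add (s := y / x - 1)
    (by linarith [div_pos hy hx]) hp
  rw [add_sub_cancel, Real.div_rpow hy.le hx.le, le_div_iff₀ (Real.rpow_pos_of_pos hx p)] at h
  have hxp : x ^ p = x ^ (p - 1) * x := by
    rw [← Real.rpow_add_one hx.ne', sub_add_cancel]
  calc x ^ p + p * x ^ (p - 1) * (y - x) = (1 + p * (y / x - 1)) * x ^ p := by
        rw [hxp]; field_simp
    _ ≤ y ^ p := h

lemma rpow_sub_one_mul_sub_le {a s p : ℝ} (ha : 0 < a) (has : a ≤ s) (hp : 1 ≤ p) :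
    a ^ (p - 1) * (s - a) ≤ s ^ p - a ^ p := by
  have hxp : ∀ x : ℝ, 0 < x → x ^ p = x ^ (p - 1) * x := fun x hx => by
    rw [← Real.rpow_add_one hx.ne', sub_add_cancel]
  have h := Real.rpow_le_rpow ha.le has (sub_nonneg.2 hp)
  rw [hxp s (ha.trans_le has), hxp a ha]
  nlinarith

lemma rpow_sub_one_mul_sub_le' {a s p : ℝ} (hs : 0 < s) (hsa : s ≤ a) (hp : 1 ≤ p) :
    a ^ (p - 1) * (a - s) ≤ a ^ p - s ^ p := by
  have hxp : ∀ x : ℝ, 0 < x → x ^ p = x ^ (p - 1) * x := fun x hx => by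
    rw [← Real.rpow_add_one hx.ne', sub_add_cancel]
  have h := Real.rpow_le_rpow hs.le hsa (sub_nonneg.2 hp)
  rw [hxp s hs, hxp a (hs.trans_le hsa)]
  nlinarith

lemma pos_of_mem_uIcc {a r s : ℝ} (ha : 0 < a) (hr : 0 < r) (hs : s ∈ Set.uIcc a r) : 0 < s :=
  (lt_min ha hr).trans_le hs.1

lemma integral_sub_div_sq {a r : ℝ} (ha : 0 < a) (hr : 0 < r) :
    ∫ s in a..r, (s - a) / s ^ 2 = Real.log (r / a) + a / r - 1 := by
  have hderiv : ∀ s ∈ Set.uIcc a r,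
      HasDerivAt (fun s => Real.log s + a * s⁻¹) ((s - a) / s ^ 2) s := fun s hs => by
    have hs0 := (pos_of_mem_uIcc ha hr hs).ne'
    refine ((Real.hasDerivAt_log hs0).add ((hasDerivAt_inv hs0).const_mul a)).congr_deriv ?_
    field_simp
    ring
  have hcont : ContinuousOn (fun s : ℝ => (s - a) / s ^ 2) (Set.uIcc a r) :=
    ContinuousOn.div (by fun_prop) (by fun_prop)
      fun s hs => pow_ne_zero 2 (pos_of_mem_uIcc ha hr hs).ne'
  rw [intervalIntegral.integral_eq_sub_of_hasDerivAt hderiv hcont.intervalIntegrable,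
    Real.log_div hr.ne' ha.ne']
  field_simp
  ring

lemma mul_integral_sub_div_sq_le {a r : ℝ} (ha : 0 < a) (hr : 0 < r) :
    r * ∫ s in a..r, (s - a) / s ^ 2 ≤ (r - a) ^ 2 / a := by
  rw [integral_sub_div_sq ha hr]
  have h := Real.log_le_sub_one_of_pos (div_pos hr ha)
  calc r * (Real.log (r / a) + a / r - 1) ≤ r * (r / a - 1 + a / r - 1) := by gcongr
    _ = (r - a) ^ 2 / a := by field_simp; ring

lemma le_mul_integral_sub_div_sq {a r : ℝ} (ha : 0 < a) (hr : 0 < r) :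
    (r - a) ^ 2 / (2 * (a + r)) ≤ r * ∫ s in a..r, (s - a) / s ^ 2 := by
  rw [integral_sub_div_sq ha hr]
  obtain ⟨u, hu, rfl⟩ : ∃ u : ℝ, 0 < u ∧ u ^ 2 = a := ⟨√a, Real.sqrt_pos.2 ha, Real.sq_sqrt ha.le⟩
  obtain ⟨v, hv, rfl⟩ : ∃ v : ℝ, 0 < v ∧ v ^ 2 = r := ⟨√r, Real.sqrt_pos.2 hr, Real.sq_sqrt hr.le⟩
  have h := Real.one_sub_inv_le_log_of_pos (div_pos hv hu)
  rw [← div_pow, Real.log_pow]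
  calc (v ^ 2 - u ^ 2) ^ 2 / (2 * (u ^ 2 + v ^ 2)) ≤ (v - u) ^ 2 := by
        rw [div_le_iff₀ (by positivity)]
        nlinarith [mul_nonneg (sq_nonneg (v - u)) (sq_nonneg (v - u))]
    _ = v ^ 2 * (2 * (1 - (v / u)⁻¹) + u ^ 2 / v ^ 2 - 1) := by field_simp; ring
    _ ≤ v ^ 2 * ((2 : ℕ) * Real.log (v / u) + u ^ 2 / v ^ 2 - 1) := by
        push_cast
        gcongr

lemma intervalIntegrable_rpow_sub_div_sq {a r : ℝ} (p : ℝ) (ha : 0 < a) (hr : 0 < r) :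
    IntervalIntegrable (fun s : ℝ => (s ^ p - a ^ p) / s ^ 2) volume a r := by
  refine ContinuousOn.intervalIntegrable (ContinuousOn.div (ContinuousOn.sub ?_ (by fun_prop))
    (by fun_prop) fun s hs => pow_ne_zero 2 (pos_of_mem_uIcc ha hr hs).ne')
  exact continuousOn_id.rpow_const fun s hs => Or.inl (pos_of_mem_uIcc ha hr hs).ne'

lemma intervalIntegrable_sub_div_sq {a r : ℝ} (ha : 0 < a) (hr : 0 < r) :
    IntervalIntegrable (fun s : ℝ => (s - a) / s ^ 2) volume a r := by
  simpa using intervalIntegrable_rpow_sub_div_sq 1 ha hr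

lemma le_integral_rpow_sub_div_sq {a r p : ℝ} (ha : 0 < a) (hr : 0 < r) (hp : 1 ≤ p) :
    a ^ (p - 1) * ∫ s in a..r, (s - a) / s ^ 2 ≤ ∫ s in a..r, (s ^ p - a ^ p) / s ^ 2 := by
  rw [← sub_nonneg, ← intervalIntegral.integral_const_mul, ← intervalIntegral.integral_sub
    (intervalIntegrable_rpow_sub_div_sq p ha hr)
    ((intervalIntegrable_sub_div_sq ha hr).const_mul _)]
  simp only [← mul_div_assoc, ← sub_div]
  refine intervalIntegral_nonneg_of_sign (fun s hs => div_nonneg ?_ (sq_nonneg s))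
    fun s hs => div_nonpos_of_nonpos_of_nonneg ?_ (sq_nonneg s)
  · linarith [rpow_sub_one_mul_sub_le ha hs.1 hp]
  · linarith [rpow_sub_one_mul_sub_le' (hr.trans_le hs.1) hs.2 hp]

lemma integral_rpow_sub_div_sq_le {a r p M : ℝ} (ha : 0 < a) (hr : 0 < r) (hp : 1 ≤ p)
    (haM : a ≤ M) (hrM : r ≤ M) :
    ∫ s in a..r, (s ^ p - a ^ p) / s ^ 2 ≤ p * M ^ (p - 1) * ∫ s in a..r, (s - a) / s ^ 2 := by
  rw [← sub_nonneg, ← intervalIntegral.integral_const_mul, ← intervalIntegral.integral_sub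
    ((intervalIntegrable_sub_div_sq ha hr).const_mul _)
    (intervalIntegrable_rpow_sub_div_sq p ha hr)]
  simp only [← mul_div_assoc, ← sub_div]
  refine intervalIntegral_nonneg_of_sign (fun s hs => div_nonneg ?_ (sq_nonneg s))
    fun s hs => div_nonpos_of_nonpos_of_nonneg ?_ (sq_nonneg s)
  · have hs0 : 0 < s := ha.trans_le hs.1
    have hpow := Real.rpow_le_rpow hs0.le (hs.2.trans hrM) (sub_nonneg.2 hp)
    have h : p * s ^ (p - 1) * (s - a) ≤ p * M ^ (p - 1) * (s - a) := by
      have := sub_nonneg.2 hs.1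
      gcongr
    linarith [rpow_add_mul_sub_le_rpow hs0 ha hp]
  · have hpow := Real.rpow_le_rpow ha.le haM (sub_nonneg.2 hp)
    have h : p * a ^ (p - 1) * (a - s) ≤ p * M ^ (p - 1) * (a - s) := by
      have := sub_nonneg.2 hs.2
      gcongr
    linarith [rpow_add_mul_sub_le_rpow ha (hr.trans_le hs.1) hp]

/-- Lemma 2.2(1): two-sided quadratic bounds for the pressure potential
    f(γ, r; r₀) = r ∫_{r₀}^{r} (s^γ − r₀^γ)/s² ds on (0, rbar]. -/
theorem pressure_potential_two_sided_bounds
    (r₀ rbar γ : ℝ) (hr₀ : 0 < r₀) (hrbar : 0 < rbar) (hγ : 1 ≤ γ) :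
    ∃ C : ℝ, 1 ≤ C ∧ ∀ r : ℝ, 0 < r → r ≤ rbar →
      (1 / C) * (r - r₀) ^ 2 ≤ r * ∫ s in r₀..r, (s ^ γ - r₀ ^ γ) / s ^ 2 ∧
      r * (∫ s in r₀..r, (s ^ γ - r₀ ^ γ) / s ^ 2) ≤ C * (r - r₀) ^ 2 := by
  set K := γ * (r₀ + rbar) ^ (γ - 1)
  have hc : 0 < r₀ ^ (γ - 1) := Real.rpow_pos_of_pos hr₀ _
  have hK0 : 0 < K := by positivity
  have hA : 0 < K / r₀ := by positivity
  have hB : 0 < 2 * (r₀ + rbar) / r₀ ^ (γ - 1) := by positivity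
  refine ⟨1 + K / r₀ + 2 * (r₀ + rbar) / r₀ ^ (γ - 1), by linarith, fun r hr hrb => ⟨?_, ?_⟩⟩
  · calc _ ≤ 1 / (2 * (r₀ + rbar) / r₀ ^ (γ - 1)) * (r - r₀) ^ 2 := by
          gcongr
          linarith
      _ = r₀ ^ (γ - 1) * ((r - r₀) ^ 2 / (2 * (r₀ + rbar))) := by field_simp
      _ ≤ r₀ ^ (γ - 1) * ((r - r₀) ^ 2 / (2 * (r₀ + r))) := by gcongr
      _ ≤ r₀ ^ (γ - 1) * (r * ∫ s in r₀..r, (s - r₀) / s ^ 2) := by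
          gcongr
          exact le_mul_integral_sub_div_sq hr₀ hr
      _ = r * (r₀ ^ (γ - 1) * ∫ s in r₀..r, (s - r₀) / s ^ 2) := by ring
      _ ≤ _ := by
          gcongr
          exact le_integral_rpow_sub_div_sq hr₀ hr hγ
  · calc _ ≤ r * (K * ∫ s in r₀..r, (s - r₀) / s ^ 2) := by
          gcongr
          exact integral_rpow_sub_div_sq_le hr₀ hr hγ (by linarith) (by linarith)
      _ = K * (r * ∫ s in r₀..r, (s - r₀) / s ^ 2) := by ring
      _ ≤ K * ((r - r₀) ^ 2 / r₀) := by
          gcongr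
          exact mul_integral_sub_div_sq_le hr₀ hr
      _ = K / r₀ * (r - r₀) ^ 2 := by ring
      _ ≤ _ := by
          gcongr
          linarith
end

section
/- Let (Ω, μ) be a measure space, let 0 < a < 1 < b, and let f : Ω → ℝ be measurable with a ≤ f(x) ≤ b for μ-almost every x. Set C(a) := max{1, (ln a / (1 − a))²} and C(b) := min{1, (ln b / (b − 1))²}. Then C(b) ∫_Ω (f − 1)² dμ ≤ ∫_Ω (ln f)² dμ ≤ C(a) ∫_Ω (f − 1)² dμ. -/
open MeasureTheory

/-- The graph of the logarithm lies above its chords. -/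
theorem chord_le_log {x y t : ℝ} (hx : 0 < x) (hxy : x < y) (hxt : x ≤ t) (hty : t ≤ y) :
    (y - t) * Real.log x + (t - x) * Real.log y ≤ (y - x) * Real.log t := by
  have hd : 0 < y - x := sub_pos.2 hxy
  have h := strictConcaveOn_log_Ioi.concaveOn.2 (Set.mem_Ioi.2 hx) (Set.mem_Ioi.2 (hx.trans hxy))
    (div_nonneg (sub_nonneg.2 hty) hd.le) (div_nonneg (sub_nonneg.2 hxt) hd.le)
    (by field_simp; ring)
  have ht : ((y - t) / (y - x)) • x + ((t - x) / (y - x)) • y = t := by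
    simp only [smul_eq_mul]
    field_simp
    ring
  rw [ht, smul_eq_mul, smul_eq_mul, div_mul_eq_mul_div, div_mul_eq_mul_div, ← add_div,
    div_le_iff₀ hd] at h
  linarith

theorem min_mul_sq_le_log_sq {b t : ℝ} (hb : 1 < b) (ht : 0 < t) (htb : t ≤ b) :
    min 1 ((Real.log b / (b - 1)) ^ 2) * (t - 1) ^ 2 ≤ Real.log t ^ 2 := by
  have hlog := Real.log_le_sub_one_of_pos ht
  rcases le_total t 1 with h1 | h1
  · calc
      _ ≤ 1 * (t - 1) ^ 2 := by gcongr; exact min_le_left _ _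
      _ ≤ Real.log t ^ 2 := by nlinarith
  · have hc := chord_le_log one_pos hb h1 htb
    have hd : 0 < b - 1 := sub_pos.2 hb
    have hlb : 0 ≤ Real.log b := Real.log_nonneg hb.le
    calc
      _ ≤ (Real.log b / (b - 1)) ^ 2 * (t - 1) ^ 2 := by gcongr; exact min_le_right _ _
      _ = (Real.log b / (b - 1) * (t - 1)) ^ 2 := by ring
      _ ≤ Real.log t ^ 2 := by
        refine pow_le_pow_left₀ (mul_nonneg (div_nonneg hlb hd.le) (sub_nonneg.2 h1)) ?_ 2
        rw [div_mul_eq_mul_div, div_le_iff₀ hd]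
        rw [Real.log_one] at hc
        linarith

theorem log_sq_le_max_mul_sq {a t : ℝ} (ha : 0 < a) (ha1 : a < 1) (hat : a ≤ t) :
    Real.log t ^ 2 ≤ max 1 ((Real.log a / (1 - a)) ^ 2) * (t - 1) ^ 2 := by
  have hlog := Real.log_le_sub_one_of_pos (ha.trans_le hat)
  rcases le_total t 1 with h1 | h1
  · have hc := chord_le_log ha ha1 hat h1
    have hd : 0 < 1 - a := sub_pos.2 ha1
    have hlt : Real.log t ≤ 0 := by linarith
    calc
      Real.log t ^ 2 = (-Real.log t) ^ 2 := by ring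
      _ ≤ (-Real.log a * (1 - t) / (1 - a)) ^ 2 := by
        refine pow_le_pow_left₀ (neg_nonneg.2 hlt) ?_ 2
        rw [le_div_iff₀ hd]
        rw [Real.log_one] at hc
        linarith
      _ = (Real.log a / (1 - a)) ^ 2 * (t - 1) ^ 2 := by ring
      _ ≤ _ := by gcongr; exact le_max_right _ _
  · calc
      Real.log t ^ 2 ≤ 1 * (t - 1) ^ 2 := by nlinarith [Real.log_nonneg h1]
      _ ≤ _ := by gcongr; exact le_max_left _ _

/-- Lemma 2.3: for a measurable f with a ≤ f ≤ b μ-a.e. (0 < a < 1 < b),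
    C(b) ∫ (f − 1)² dμ ≤ ∫ (ln f)² dμ ≤ C(a) ∫ (f − 1)² dμ, where
    C(a) = max{1, (ln a/(1 − a))²} and C(b) = min{1, (ln b/(b − 1))²}. -/
theorem log_sq_integral_quadratic_bounds
    {Ω : Type*} [MeasurableSpace Ω] (μ : Measure Ω)
    (a b : ℝ) (ha : 0 < a) (ha1 : a < 1) (hb : 1 < b)
    (f : Ω → ℝ) (hf : Measurable f)
    (hab : ∀ᵐ x ∂μ, a ≤ f x ∧ f x ≤ b) :
    ENNReal.ofReal (min 1 ((Real.log b / (b - 1)) ^ 2)) *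
        (∫⁻ x, ENNReal.ofReal ((f x - 1) ^ 2) ∂μ) ≤
      (∫⁻ x, ENNReal.ofReal ((Real.log (f x)) ^ 2) ∂μ) ∧
    (∫⁻ x, ENNReal.ofReal ((Real.log (f x)) ^ 2) ∂μ) ≤
      ENNReal.ofReal (max 1 ((Real.log a / (1 - a)) ^ 2)) *
        (∫⁻ x, ENNReal.ofReal ((f x - 1) ^ 2) ∂μ) := by
  have hm : Measurable fun x => ENNReal.ofReal ((f x - 1) ^ 2) := by fun_prop
  rw [← lintegral_const_mul _ hm, ← lintegral_const_mul _ hm]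
  constructor <;> refine lintegral_mono_ae ?_ <;> filter_upwards [hab] with x ⟨hax, hxb⟩
  · rw [← ENNReal.ofReal_mul (le_min zero_le_one (sq_nonneg _))]
    exact ENNReal.ofReal_le_ofReal (min_mul_sq_le_log_sq hb (ha.trans_le hax) hxb)
  · rw [← ENNReal.ofReal_mul (zero_le_one.trans (le_max_left _ _))]
    exact ENNReal.ofReal_le_ofReal (log_sq_le_max_mul_sq ha ha1 hax)
end

section
/- Let γ > 1, μ > 0 and λ ∈ ℝ with λ + 2μ > 0. Let ρ, n : ℝ³ × ℝ → ℝ and u, v : ℝ³ × ℝ → ℝ³ be smooth functions, ℤ³-periodic in the space variable, with ρ(x, t) > 0 and n(x, t) > 0 everywhere, satisfying: ∂_t ρ + div(ρu) = 0, ∂_t(ρu) + div(ρ u ⊗ u) + ∇ρ = −ρ(u − v), ∂_t n + div(nv) = 0, ∂_t(nv) + div(n v ⊗ v) + ∇(n^γ) + Lv = ρ(u − v), where Lv = −μ Δv − (μ + λ)∇(div v). Define the total energy E(t) := ∫_{[0,1]³} ρ|u|² dx + 2 ∫_{[0,1]³} ρ ln ρ dx + ∫_{[0,1]³} n|v|²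 dx + (2/(γ−1)) ∫_{[0,1]³} n^γ dx. Then for every t, E is differentiable and (1/2) E′(t) + μ ∫_{[0,1]³} |∇v|² dx + (μ + λ) ∫_{[0,1]³} |div v|² dx + ∫_{[0,1]³} ρ |u − v|² dx = 0. -/
open MeasureTheory

/-- Spatial partial derivative in the i-th coordinate direction. -/
noncomputable def pd (i : Fin 3) (f : (Fin 3 → ℝ) → ℝ) (x : Fin 3 → ℝ) : ℝ :=
  fderiv ℝ f x (Pi.single i 1)

section DirectionalDerivative

variable {E : Type*} [NormedAddCommGroup E] [NormedSpace ℝ E]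

/-- The derivative of `f` at `p` in the direction `w`. -/
noncomputable def dirDeriv (w : E) (f : E → ℝ) (p : E) : ℝ :=
  fderiv ℝ f p w

theorem ContDiff.dirDeriv {f : E → ℝ} (hf : ContDiff ℝ (⊤ : ℕ∞) f) (w : E) :
    ContDiff ℝ (⊤ : ℕ∞) (dirDeriv w f) :=
  (hf.fderiv_right (m := (⊤ : ℕ∞)) (by simp)).clm_apply contDiff_const

theorem dirDeriv_add {f g : E → ℝ} {p : E} (w : E) (hf : DifferentiableAt ℝ f p)
    (hg : DifferentiableAt ℝ g p) :
    dirDeriv w (fun q => f q + g q) p = dirDeriv w f p + dirDeriv w g p := by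
  simp [dirDeriv, fderiv_fun_add hf hg]

theorem dirDeriv_mul {f g : E → ℝ} {p : E} (w : E) (hf : DifferentiableAt ℝ f p)
    (hg : DifferentiableAt ℝ g p) :
    dirDeriv w (fun q => f q * g q) p = f p * dirDeriv w g p + g p * dirDeriv w f p := by
  simp [dirDeriv, fderiv_fun_mul hf hg]

theorem dirDeriv_const_mul {f : E → ℝ} {p : E} (w : E) (c : ℝ) (hf : DifferentiableAt ℝ f p) :
    dirDeriv w (fun q => c * f q) p = c * dirDeriv w f p := by
  simp [dirDeriv, fderiv_const_mul hf c]

theorem dirDeriv_sum {ι : Type*} (s : Finset ι) {f : ι → E → ℝ} {p : E} (w : E)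
    (hf : ∀ i ∈ s, DifferentiableAt ℝ (f i) p) :
    dirDeriv w (fun q => ∑ i ∈ s, f i q) p = ∑ i ∈ s, dirDeriv w (f i) p := by
  simp [dirDeriv, fderiv_fun_sum hf]

theorem dirDeriv_comp {h : ℝ → ℝ} {h' : ℝ} {f : E → ℝ} {p : E} (w : E)
    (hh : HasDerivAt h h' (f p)) (hf : DifferentiableAt ℝ f p) :
    dirDeriv w (fun q => h (f q)) p = h' * dirDeriv w f p := by
  have := (hh.comp_hasFDerivAt p hf.hasFDerivAt).fderiv
  simp only [Function.comp_def] at this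
  simp [dirDeriv, this]

theorem dirDeriv_mul_sq {r a : E → ℝ} {p : E} (w : E) (hr : DifferentiableAt ℝ r p)
    (ha : DifferentiableAt ℝ a p) :
    dirDeriv w (fun q => r q * a q ^ 2) p
      = 2 * a p * dirDeriv w (fun q => r q * a q) p - a p ^ 2 * dirDeriv w r p := by
  simp only [pow_two]
  rw [dirDeriv_mul w hr (ha.fun_mul ha), dirDeriv_mul w ha ha, dirDeriv_mul w hr ha]
  ring

variable {ι : Type*} [Fintype ι]

/-- Kinetic energy balance, from the balance of mass and momentum. -/
theorem dirDeriv_kinetic_energy {r : E → ℝ} {u : E → ι → ℝ} {p w : E} {e : ι → E} {F : ι → ℝ}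
    (hr : Differentiable ℝ r) (hu : Differentiable ℝ u)
    (hmass : dirDeriv w r p + ∑ j, dirDeriv (e j) (fun q => r q * u q j) p = 0)
    (hmom : ∀ i, dirDeriv w (fun q => r q * u q i) p
      + ∑ j, dirDeriv (e j) (fun q => r q * u q i * u q j) p = F i) :
    dirDeriv w (fun q => r q * ∑ i, u q i ^ 2) p
      + ∑ j, dirDeriv (e j) (fun q => r q * (∑ i, u q i ^ 2) * u q j) p
      = 2 * ∑ i, u p i * F i := by
  have hui (i : ι) : Differentiable ℝ (fun q => u q i) := by fun_prop
  have hflux (j : ι) : (fun q => r q * (∑ i, u q i ^ 2) * u q j)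
      = fun q => ∑ i, (r q * u q j) * u q i ^ 2 := by
    funext q
    rw [mul_right_comm, Finset.mul_sum]
  have hswap (i j : ι) : (fun q => r q * u q j * u q i) = fun q => r q * u q i * u q j := by
    funext q
    ring
  have hdens : (fun q => r q * ∑ i, u q i ^ 2) = fun q => ∑ i, r q * u q i ^ 2 := by
    simp only [Finset.mul_sum]
  simp only [hflux, hdens]
  rw [Finset.mul_sum, dirDeriv_sum _ _ (fun i _ => by fun_prop)]
  simp_rw [dirDeriv_sum Finset.univ (e _) (fun i _ =>
    ((hr.fun_mul (hui _)).fun_mul ((hui i).fun_pow 2)) p)]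
  rw [Finset.sum_comm, ← Finset.sum_add_distrib]
  refine Finset.sum_congr rfl fun i _ => ?_
  rw [dirDeriv_mul_sq w (hr p) (hui i p)]
  simp_rw [fun j => dirDeriv_mul_sq (e j) ((hr.fun_mul (hui j)) p) (hui i p), hswap i]
  rw [Finset.sum_sub_distrib, ← Finset.mul_sum, ← Finset.mul_sum]
  linear_combination 2 * u p i * hmom i - u p i ^ 2 * hmass

/-- Internal energy balance, from the balance of mass: `h` is the energy density as a function of
position and `g` its derivative with respect to the density. -/
theorem dirDeriv_internal_energy {r h g : E → ℝ} {u : E → ι → ℝ} {p w : E} {e : ι → E}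
    (hr : Differentiable ℝ r) (hu : Differentiable ℝ u) (hg : Differentiable ℝ g)
    (hh : dirDeriv w h p = g p * dirDeriv w r p)
    (hmass : dirDeriv w r p + ∑ j, dirDeriv (e j) (fun q => r q * u q j) p = 0) :
    dirDeriv w h p + ∑ j, dirDeriv (e j) (fun q => g q * (r q * u q j)) p
      = ∑ j, r p * u p j * dirDeriv (e j) g p := by
  have hui (i : ι) : Differentiable ℝ (fun q => u q i) := by fun_prop
  simp_rw [fun j => dirDeriv_mul (e j) (hg p) ((hr.fun_mul (hui j)) p)]
  rw [hh, Finset.sum_add_distrib, ← Finset.mul_sum]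
  linear_combination g p * hmass

end DirectionalDerivative

theorem hasDerivAt_slice {X : Type*} [NormedAddCommGroup X] [NormedSpace ℝ X]
    {f : X × ℝ → ℝ} (hf : Differentiable ℝ f) (x : X) (t : ℝ) :
    HasDerivAt (fun s => f (x, s)) (dirDeriv (0, 1) f (x, t)) t := by
  have h : HasDerivAt (fun s : ℝ => (x, s)) ((0 : X), (1 : ℝ)) t :=
    (hasDerivAt_const t x).prodMk (hasDerivAt_id t)
  exact (hf (x, t)).hasFDerivAt.comp_hasDerivAt t h

theorem hasFDerivAt_slice {X : Type*} [NormedAddCommGroup X] [NormedSpace ℝ X]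
    {f : X × ℝ → ℝ} (hf : Differentiable ℝ f) (x : X) (t : ℝ) :
    HasFDerivAt (fun y => f (y, t)) ((fderiv ℝ f (x, t)).comp (.inl ℝ X ℝ)) x :=
  (hf (x, t)).hasFDerivAt.comp x (hasFDerivAt_prodMk_left x t)

/-- The direction of the `j`-th space coordinate in space-time. -/
noncomputable def spaceDir (j : Fin 3) : (Fin 3 → ℝ) × ℝ := (Pi.single j 1, 0)

theorem pd_slice {f : (Fin 3 → ℝ) × ℝ → ℝ} (hf : Differentiable ℝ f) (j : Fin 3)
    (x : Fin 3 → ℝ) (t : ℝ) :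
    pd j (fun y => f (y, t)) x = dirDeriv (spaceDir j) f (x, t) := by
  simp [pd, (hasFDerivAt_slice hf x t).fderiv, dirDeriv, spaceDir]

/-- Differentiation under the integral sign over a compact set. -/
theorem hasDerivAt_setIntegral_of_contDiff {f : (Fin 3 → ℝ) × ℝ → ℝ} {K : Set (Fin 3 → ℝ)}
    (hK : IsCompact K) (hf : ContDiff ℝ (⊤ : ℕ∞) f) (t : ℝ) :
    HasDerivAt (fun τ => ∫ x in K, f (x, τ)) (∫ x in K, dirDeriv (0, 1) f (x, t)) t := by
  have hd : Continuous (dirDeriv ((0 : Fin 3 → ℝ), (1 : ℝ)) f) := (hf.dirDeriv _).continuous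
  have hfc : Continuous f := hf.continuous
  obtain ⟨C, hC⟩ := (hK.prod (isCompact_closedBall t 1)).exists_bound_of_continuousOn
    hd.continuousOn
  refine (hasDerivAt_integral_of_dominated_loc_of_deriv_le (bound := fun _ => C)
    (F' := fun τ x => dirDeriv (0, 1) f (x, τ)) (Metric.closedBall_mem_nhds t one_pos)
    (.of_forall fun τ => ?_) ?_ ?_ ?_ ?_ (.of_forall fun x τ _ => ?_)).2
  · exact (by fun_prop : Continuous fun x => f (x, τ)).aestronglyMeasurable
  · exact (by fun_prop : Continuous fun x => f (x, t)).continuousOn.integrableOn_compact hK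
  · exact (by fun_prop : Continuous fun x => dirDeriv (0, 1) f (x, t)).aestronglyMeasurable
  · filter_upwards [ae_restrict_mem hK.measurableSet] with x hx τ hτ using hC (x, τ) ⟨hx, hτ⟩
  · exact (continuous_const (y := C)).continuousOn.integrableOn_compact hK
  · exact hasDerivAt_slice (hf.differentiable (by simp)) x τ

/-- The divergence of a periodic vector field integrates to zero over the unit cube. -/
theorem setIntegral_divergence_eq_zero {G : Fin 3 → (Fin 3 → ℝ) × ℝ → ℝ}
    (hG : ∀ j, ContDiff ℝ (⊤ : ℕ∞) (G j)) (t : ℝ)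
    (hper : ∀ j x (k : Fin 3 → ℤ), G j (x + fun i => (k i : ℝ), t) = G j (x, t)) :
    ∫ x in Set.Icc (0 : Fin 3 → ℝ) 1, ∑ j, dirDeriv (spaceDir j) (G j) (x, t) = 0 := by
  have hd (j) : Continuous (dirDeriv (spaceDir j) (G j)) := ((hG j).dirDeriv _).continuous
  have hc (j) : Continuous (G j) := (hG j).continuous
  have key := integral_divergence_of_hasFDerivAt_off_countable' (0 : Fin 3 → ℝ) 1 zero_le_one
    (fun j x => G j (x, t)) (fun j x => (fderiv ℝ (G j) (x, t)).comp (.inl ℝ _ ℝ)) ∅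
    Set.countable_empty (fun j => by fun_prop)
    (fun x _ j => hasFDerivAt_slice ((hG j).differentiable (by simp)) x t)
    (Continuous.integrableOn_Icc (by
      change Continuous fun x => ∑ j, dirDeriv (spaceDir j) (G j) (x, t)
      fun_prop))
  refine key.trans (Finset.sum_eq_zero fun j _ => sub_eq_zero.2 ?_)
  congr 1
  funext x
  rw [← hper j (j.insertNth ((0 : Fin 3 → ℝ) j) x) (Pi.single j 1)]
  congr 2
  funext i
  refine j.succAboveCases ?_ (fun l => ?_) i <;> simp [Fin.succAbove_ne]

/-- Lemma 2.4(ii), energy dissipation: for smooth ℤ³-periodic positive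
solutions of the two-phase system, the total energy
E(t) = ∫ρ|u|² + 2∫ρ ln ρ + ∫n|v|² + (2/(γ−1))∫n^γ satisfies
(1/2)E′(t) + μ∫|∇v|² + (μ+λ)∫|div v|² + ∫ρ|u−v|² = 0. -/
theorem energy_dissipation
    (γ μ lam : ℝ) (hγ : 1 < γ) (hμ : 0 < μ) (hlam : 0 < lam + 2 * μ)
    (ρ n : (Fin 3 → ℝ) × ℝ → ℝ) (u v : (Fin 3 → ℝ) × ℝ → Fin 3 → ℝ)
    (hρ : ContDiff ℝ (⊤ : ℕ∞) ρ) (hn : ContDiff ℝ (⊤ : ℕ∞) n)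
    (hu : ContDiff ℝ (⊤ : ℕ∞) u) (hv : ContDiff ℝ (⊤ : ℕ∞) v)
    (hρper : ∀ (x : Fin 3 → ℝ) (t : ℝ) (k : Fin 3 → ℤ),
      ρ ((x + fun i => (k i : ℝ)), t) = ρ (x, t))
    (hnper : ∀ (x : Fin 3 → ℝ) (t : ℝ) (k : Fin 3 → ℤ),
      n ((x + fun i => (k i : ℝ)), t) = n (x, t))
    (huper : ∀ (x : Fin 3 → ℝ) (t : ℝ) (k : Fin 3 → ℤ),
      u ((x + fun i => (k i : ℝ)), t) = u (x, t))
    (hvper : ∀ (x : Fin 3 → ℝ) (t : ℝ) (k : Fin 3 → ℤ),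
      v ((x + fun i => (k i : ℝ)), t) = v (x, t))
    (hρpos : ∀ p, 0 < ρ p) (hnpos : ∀ p, 0 < n p)
    -- continuity equation for ρ
    (heq1 : ∀ (x : Fin 3 → ℝ) (t : ℝ),
      deriv (fun s => ρ (x, s)) t
        + ∑ i, pd i (fun y => ρ (y, t) * u (y, t) i) x = 0)
    -- momentum equation for ρu (isothermal Euler with drag)
    (heq2 : ∀ (x : Fin 3 → ℝ) (t : ℝ) (i : Fin 3),
      deriv (fun s => ρ (x, s) * u (x, s) i) t
        + ∑ j, pd j (fun y => ρ (y, t) * u (y, t) i * u (y, t) j) x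
        + pd i (fun y => ρ (y, t)) x
        = -(ρ (x, t) * (u (x, t) i - v (x, t) i)))
    -- continuity equation for n
    (heq3 : ∀ (x : Fin 3 → ℝ) (t : ℝ),
      deriv (fun s => n (x, s)) t
        + ∑ i, pd i (fun y => n (y, t) * v (y, t) i) x = 0)
    -- momentum equation for nv (isentropic Navier–Stokes with drag),
    -- with Lv = −μΔv − (μ+λ)∇(div v)
    (heq4 : ∀ (x : Fin 3 → ℝ) (t : ℝ) (i : Fin 3),
      deriv (fun s => n (x, s) * v (x, s) i) t
        + ∑ j, pd j (fun y => n (y, t) * v (y, t) i * v (y, t) j) x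
        + pd i (fun y => n (y, t) ^ γ) x
        + (-(μ * ∑ j, pd j (fun y => pd j (fun z => v (z, t) i) y) x)
            - (μ + lam) * pd i (fun y => ∑ j, pd j (fun z => v (z, t) j) y) x)
        = ρ (x, t) * (u (x, t) i - v (x, t) i)) :
    ∀ t : ℝ,
      HasDerivAt (fun τ =>
          (∫ x in Set.Icc (0 : Fin 3 → ℝ) 1, ρ (x, τ) * ∑ i, (u (x, τ) i) ^ 2)
          + 2 * (∫ x in Set.Icc (0 : Fin 3 → ℝ) 1, ρ (x, τ) * Real.log (ρ (x, τ)))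
          + (∫ x in Set.Icc (0 : Fin 3 → ℝ) 1, n (x, τ) * ∑ i, (v (x, τ) i) ^ 2)
          + (2 / (γ - 1)) * ∫ x in Set.Icc (0 : Fin 3 → ℝ) 1, n (x, τ) ^ γ)
        (-2 * (μ * (∫ x in Set.Icc (0 : Fin 3 → ℝ) 1,
                ∑ i, ∑ j, (pd j (fun y => v (y, t) i) x) ^ 2)
            + (μ + lam) * (∫ x in Set.Icc (0 : Fin 3 → ℝ) 1,
                (∑ j, pd j (fun y => v (y, t) j) x) ^ 2)
            + ∫ x in Set.Icc (0 : Fin 3 → ℝ) 1,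
                ρ (x, t) * ∑ i, (u (x, t) i - v (x, t) i) ^ 2)) t := by
  intro t
  have hγ' : γ - 1 ≠ 0 := by linarith
  have hρne (q) : ρ q ≠ 0 := (hρpos q).ne'
  have hnne (q) : n q ≠ 0 := (hnpos q).ne'
  have hui (i) : ContDiff ℝ (⊤ : ℕ∞) (fun q => u q i) := by fun_prop
  have hvi (i) : ContDiff ℝ (⊤ : ℕ∞) (fun q => v q i) := by fun_prop
  have hlog : ContDiff ℝ (⊤ : ℕ∞) (fun q => Real.log (ρ q)) := hρ.log hρne
  have hpow (a : ℝ) : ContDiff ℝ (⊤ : ℕ∞) (fun q => n q ^ a) := hn.rpow_const_of_ne hnne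
  have hDv (i j) : ContDiff ℝ (⊤ : ℕ∞) (dirDeriv (spaceDir j) (fun q => v q i)) :=
    (hvi i).dirDeriv _
  have dρ : Differentiable ℝ ρ := hρ.differentiable (by simp)
  have dn : Differentiable ℝ n := hn.differentiable (by simp)
  have du : Differentiable ℝ u := hu.differentiable (by simp)
  have dv : Differentiable ℝ v := hv.differentiable (by simp)
  have dui (i) : Differentiable ℝ (fun q => u q i) := (hui i).differentiable (by simp)
  have dvi (i) : Differentiable ℝ (fun q => v q i) := (hvi i).differentiable (by simp)
  have dlog : Differentiable ℝ (fun q => Real.log (ρ q)) := hlog.differentiable (by simp)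
  have dpow (a : ℝ) : Differentiable ℝ (fun q => n q ^ a) := (hpow a).differentiable (by simp)
  have dDv (i j) : Differentiable ℝ (dirDeriv (spaceDir j) (fun q => v q i)) :=
    (hDv i j).differentiable (by simp)
  have hpdv (i j x) : pd j (fun z => v (z, t) i) x
      = dirDeriv (spaceDir j) (fun q => v q i) (x, t) := pd_slice (dvi i) j x t
  -- the four equations in terms of space-time directional derivatives
  have mass₁ (x) : dirDeriv (0, 1) ρ (x, t)
      + ∑ j, dirDeriv (spaceDir j) (fun q => ρ q * u q j) (x, t) = 0 := by
    have h := heq1 x t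
    rw [(hasDerivAt_slice dρ x t).deriv] at h
    simpa only [fun j => pd_slice (dρ.fun_mul (dui j)) j x t] using h
  have mass₂ (x) : dirDeriv (0, 1) n (x, t)
      + ∑ j, dirDeriv (spaceDir j) (fun q => n q * v q j) (x, t) = 0 := by
    have h := heq3 x t
    rw [(hasDerivAt_slice dn x t).deriv] at h
    simpa only [fun j => pd_slice (dn.fun_mul (dvi j)) j x t] using h
  have mom₁ (x i) : dirDeriv (0, 1) (fun q => ρ q * u q i) (x, t)
      + ∑ j, dirDeriv (spaceDir j) (fun q => ρ q * u q i * u q j) (x, t)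
      = -(ρ (x, t) * (u (x, t) i - v (x, t) i)) - dirDeriv (spaceDir i) ρ (x, t) := by
    have h := heq2 x t i
    rw [(hasDerivAt_slice (dρ.fun_mul (dui i)) x t).deriv, pd_slice dρ i x t] at h
    simp only [fun j => pd_slice ((dρ.fun_mul (dui i)).fun_mul (dui j)) j x t] at h
    linear_combination h
  have mom₂ (x i) : dirDeriv (0, 1) (fun q => n q * v q i) (x, t)
      + ∑ j, dirDeriv (spaceDir j) (fun q => n q * v q i * v q j) (x, t)
      = ρ (x, t) * (u (x, t) i - v (x, t) i) - dirDeriv (spaceDir i) (fun q => n q ^ γ) (x, t)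
        + μ * ∑ j, dirDeriv (spaceDir j) (dirDeriv (spaceDir j) (fun q => v q i)) (x, t)
        + (μ + lam) * ∑ j, dirDeriv (spaceDir i) (dirDeriv (spaceDir j) (fun q => v q j)) (x, t) := by
    have h := heq4 x t i
    rw [(hasDerivAt_slice (dn.fun_mul (dvi i)) x t).deriv, pd_slice (dpow γ) i x t] at h
    simp only [fun j => pd_slice ((dn.fun_mul (dvi i)).fun_mul (dvi j)) j x t, hpdv,
      fun j => pd_slice (dDv i j) j x t] at h
    rw [pd_slice (f := fun q => ∑ j, dirDeriv (spaceDir j) (fun q => v q j) q) (by fun_prop) i x t,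
      dirDeriv_sum _ _ (fun j _ => dDv j j (x, t))] at h
    linear_combination h
  -- the internal energies
  have internal₁ (x) : dirDeriv (0, 1) (fun q => ρ q * Real.log (ρ q)) (x, t)
      + ∑ j, dirDeriv (spaceDir j) (fun q => (Real.log (ρ q) + 1) * (ρ q * u q j)) (x, t)
      = ∑ j, u (x, t) j * dirDeriv (spaceDir j) ρ (x, t) := by
    rw [dirDeriv_internal_energy dρ du (dlog.add_const 1) _ (mass₁ x)]
    · refine Finset.sum_congr rfl fun j _ => ?_
      rw [dirDeriv_comp (h := fun y => Real.log y + 1) _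
        ((Real.hasDerivAt_log (hρne _)).add_const 1) (dρ _)]
      field_simp [hρne (x, t)]
    · exact dirDeriv_comp (h := fun y => y * Real.log y) _
        (Real.hasDerivAt_mul_log (hρne _)) (dρ _)
  have internal₂ (x) : dirDeriv (0, 1) (fun q => n q ^ γ) (x, t)
      + ∑ j, dirDeriv (spaceDir j) (fun q => (γ * n q ^ (γ - 1)) * (n q * v q j)) (x, t)
      = (γ - 1) * ∑ j, v (x, t) j * dirDeriv (spaceDir j) (fun q => n q ^ γ) (x, t) := by
    have hD (a : ℝ) (w) : dirDeriv w (fun q => n q ^ a) (x, t)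
        = a * n (x, t) ^ (a - 1) * dirDeriv w n (x, t) :=
      dirDeriv_comp w (Real.hasDerivAt_rpow_const (.inl (hnne _))) (dn _)
    rw [dirDeriv_internal_energy dn dv ((dpow (γ - 1)).const_mul γ) (hD γ _) (mass₂ x),
      Finset.mul_sum]
    refine Finset.sum_congr rfl fun j _ => ?_
    rw [dirDeriv_const_mul _ _ (dpow (γ - 1) _), hD, hD, Real.rpow_sub_one (hnne _) (γ - 1)]
    field_simp [hnne (x, t)]
  let e : (Fin 3 → ℝ) × ℝ → ℝ := fun q =>
    ρ q * ∑ i, u q i ^ 2 + 2 * (ρ q * Real.log (ρ q)) + n q * ∑ i, v q i ^ 2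
      + 2 / (γ - 1) * n q ^ γ
  let G : Fin 3 → (Fin 3 → ℝ) × ℝ → ℝ := fun j q =>
    (-1) * (ρ q * (∑ i, u q i ^ 2) * u q j)
      + (-2) * ((Real.log (ρ q) + 1) * (ρ q * u q j))
      + (-1) * (n q * (∑ i, v q i ^ 2) * v q j)
      + (-(2 / (γ - 1))) * ((γ * n q ^ (γ - 1)) * (n q * v q j))
      + (2 * μ) * (∑ i, v q i * dirDeriv (spaceDir j) (fun q => v q i) q)
      + (2 * (μ + lam)) * (v q j * ∑ i, dirDeriv (spaceDir i) (fun q => v q i) q)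
  have he : ContDiff ℝ (⊤ : ℕ∞) e := by fun_prop
  have hG (j) : ContDiff ℝ (⊤ : ℕ∞) (G j) := by fun_prop
  have hGper (j x) (k : Fin 3 → ℤ) : G j (x + fun i => (k i : ℝ), t) = G j (x, t) := by
    have hpd (i j) : dirDeriv (spaceDir j) (fun q => v q i) (x + fun i => (k i : ℝ), t)
        = dirDeriv (spaceDir j) (fun q => v q i) (x, t) := by
      rw [← hpdv, ← hpdv, pd, pd, ← fderiv_comp_add_right]
      simp only [hvper]
    simp only [G, hρper, hnper, huper, hvper, hpd]
  have balance (x) : dirDeriv (0, 1) e (x, t) = ∑ j, dirDeriv (spaceDir j) (G j) (x, t)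
      + -2 * (μ * (∑ i, ∑ j, dirDeriv (spaceDir j) (fun q => v q i) (x, t) ^ 2)
        + (μ + lam) * (∑ j, dirDeriv (spaceDir j) (fun q => v q j) (x, t)) ^ 2
        + ρ (x, t) * ∑ i, (u (x, t) i - v (x, t) i) ^ 2) := by
    have kinetic₁ := dirDeriv_kinetic_energy dρ du (mass₁ x) (mom₁ x)
    have kinetic₂ := dirDeriv_kinetic_energy dn dv (mass₂ x) (mom₂ x)
    have hc : 2 / (γ - 1) * (γ - 1) = 2 := div_mul_cancel₀ _ hγ'
    have hte : dirDeriv (0, 1) e (x, t) = dirDeriv (0, 1) (fun q => ρ q * ∑ i, u q i ^ 2) (x, t)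
        + 2 * dirDeriv (0, 1) (fun q => ρ q * Real.log (ρ q)) (x, t)
        + dirDeriv (0, 1) (fun q => n q * ∑ i, v q i ^ 2) (x, t)
        + 2 / (γ - 1) * dirDeriv (0, 1) (fun q => n q ^ γ) (x, t) := by
      simp only [e]
      rw [dirDeriv_add _ (by fun_prop) ((dpow γ).const_mul _ _),
        dirDeriv_add _ (by fun_prop) (by fun_prop),
        dirDeriv_add _ (by fun_prop) (by fun_prop), dirDeriv_const_mul _ _ (by fun_prop),
        dirDeriv_const_mul _ _ (dpow γ _)]
    have hvisc₁ (j) : dirDeriv (spaceDir j)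
          (fun q => ∑ i, v q i * dirDeriv (spaceDir j) (fun q => v q i) q) (x, t)
        = ∑ i, (v (x, t) i * dirDeriv (spaceDir j) (dirDeriv (spaceDir j) (fun q => v q i)) (x, t)
          + dirDeriv (spaceDir j) (fun q => v q i) (x, t) ^ 2) := by
      rw [dirDeriv_sum _ _ (fun i _ => by fun_prop)]
      refine Finset.sum_congr rfl fun i _ => ?_
      rw [dirDeriv_mul _ (dvi i _) (dDv i j _), pow_two]
    have hvisc₂ (j) : dirDeriv (spaceDir j)
          (fun q => v q j * ∑ i, dirDeriv (spaceDir i) (fun q => v q i) q) (x, t)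
        = v (x, t) j * ∑ i, dirDeriv (spaceDir j) (dirDeriv (spaceDir i) (fun q => v q i)) (x, t)
          + (∑ i, dirDeriv (spaceDir i) (fun q => v q i) (x, t))
            * dirDeriv (spaceDir j) (fun q => v q j) (x, t) := by
      rw [dirDeriv_mul _ (dvi j _) (by fun_prop), dirDeriv_sum _ _ (fun i _ => dDv i i _)]
    have hflux (j) : dirDeriv (spaceDir j) (G j) (x, t)
        = (-1) * dirDeriv (spaceDir j) (fun q => ρ q * (∑ i, u q i ^ 2) * u q j) (x, t)
          + (-2) * dirDeriv (spaceDir j)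
            (fun q => (Real.log (ρ q) + 1) * (ρ q * u q j)) (x, t)
          + (-1) * dirDeriv (spaceDir j) (fun q => n q * (∑ i, v q i ^ 2) * v q j) (x, t)
          + (-(2 / (γ - 1))) * dirDeriv (spaceDir j)
            (fun q => (γ * n q ^ (γ - 1)) * (n q * v q j)) (x, t)
          + (2 * μ) * dirDeriv (spaceDir j)
            (fun q => ∑ i, v q i * dirDeriv (spaceDir j) (fun q => v q i) q) (x, t)
          + (2 * (μ + lam)) * dirDeriv (spaceDir j)
            (fun q => v q j * ∑ i, dirDeriv (spaceDir i) (fun q => v q i) q) (x, t) := by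
      simp only [G]
      iterate 5 rw [dirDeriv_add _ (by fun_prop) (by fun_prop)]
      iterate 6 rw [dirDeriv_const_mul _ _ (by fun_prop)]
    have h₁ := internal₁ x
    have h₂ := internal₂ x
    rw [hte]
    simp only [hflux, hvisc₁, hvisc₂]
    simp only [Fin.sum_univ_three] at kinetic₁ kinetic₂ h₁ h₂ ⊢
    linear_combination kinetic₁ + kinetic₂ + 2 * h₁ + 2 / (γ - 1) * h₂
      + (v (x, t) 0 * dirDeriv (spaceDir 0) (fun q => n q ^ γ) (x, t)
        + v (x, t) 1 * dirDeriv (spaceDir 1) (fun q => n q ^ γ) (x, t)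
        + v (x, t) 2 * dirDeriv (spaceDir 2) (fun q => n q ^ γ) (x, t)) * hc
  have cρ : Continuous ρ := hρ.continuous
  have cn : Continuous n := hn.continuous
  have cu : Continuous u := hu.continuous
  have cv : Continuous v := hv.continuous
  have clog : Continuous (fun q => Real.log (ρ q)) := hlog.continuous
  have cpow : Continuous (fun q => n q ^ γ) := (hpow γ).continuous
  have cDv (i j) : Continuous (dirDeriv (spaceDir j) (fun q => v q i)) := (hDv i j).continuous
  have cDG (j) : Continuous (dirDeriv (spaceDir j) (G j)) := ((hG j).dirDeriv _).continuous
  convert hasDerivAt_setIntegral_of_contDiff (isCompact_Icc (a := (0 : Fin 3 → ℝ)) (b := 1)) he t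
    using 1
  · funext τ
    have cpow' : Continuous (fun x => n (x, τ) ^ γ) :=
      cpow.comp (by fun_prop : Continuous fun x => (x, τ))
    have clog' : Continuous (fun x => Real.log (ρ (x, τ))) :=
      clog.comp (by fun_prop : Continuous fun x => (x, τ))
    simp only [e]
    rw [integral_add, integral_add, integral_add, integral_const_mul, integral_const_mul]
    all_goals exact Continuous.integrableOn_Icc (by fun_prop)
  · simp only [balance, hpdv]
    rw [integral_add, setIntegral_divergence_eq_zero hG t hGper, zero_add, integral_const_mul,
      integral_add, integral_add, integral_const_mul, integral_const_mul]
    all_goals exact Continuous.integrableOn_Icc (by fun_prop)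
end

section
/- Let γ > 1, r₀ > 0 and r̄ > 0. Then there exists a constant C = C(γ, r₀, r̄) ≥ 1 such that for all r ∈ [0, r̄]: (1/C)(r − r₀)² ≤ (r^γ − γ r₀^{γ−1} r + (γ−1) r₀^γ)/(γ−1) ≤ C (r − r₀)². -/
open Set Filter Topology in
/-- A continuous function on a compact set that is positive away from `a` and has a positive
second-order quotient at `a` is comparable to `(x - a) ^ 2`. -/
theorem IsCompact.exists_quadratic_bounds {K : Set ℝ} (hK : IsCompact K) {f : ℝ → ℝ} {a L : ℝ}
    (hf : ContinuousOn f K) (ha : f a = 0) (hpos : ∀ x ∈ K, x ≠ a → 0 < f x) (hL : 0 < L)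
    (hlim : Tendsto (fun x => f x / (x - a) ^ 2) (𝓝[≠] a) (𝓝 L)) :
    ∃ C : ℝ, 1 ≤ C ∧ ∀ x ∈ K, (1 / C) * (x - a) ^ 2 ≤ f x ∧ f x ≤ C * (x - a) ^ 2 := by
  have hsq : ∀ x, x ≠ a → 0 < (x - a) ^ 2 := fun x hx => by
    have := sub_ne_zero.mpr hx
    positivity
  set g : ℝ → ℝ := Function.update (fun x => f x / (x - a) ^ 2) a L with hg
  have hg_of_ne : ∀ x, x ≠ a → g x = f x / (x - a) ^ 2 := fun x hx => by simp [hg, hx]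
  have hg_cont : ContinuousOn g K := by
    rw [hg, continuousOn_update_iff]
    refine ⟨(hf.mono sdiff_subset).div (by fun_prop) fun x hx => (hsq x hx.2).ne', fun _ => ?_⟩
    exact hlim.mono_left (nhdsWithin_mono _ fun x hx => hx.2)
  have hg_pos : ∀ x ∈ K, 0 < g x := fun x hx => by
    by_cases hxa : x = a
    · simpa [hg, hxa] using hL
    · rw [hg_of_ne x hxa]
      exact div_pos (hpos x hx hxa) (hsq x hxa)
  obtain ⟨A, hA⟩ := hK.exists_bound_of_continuousOn hg_cont
  obtain ⟨B, hB⟩ := hK.exists_bound_of_continuousOn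
    (hg_cont.inv₀ fun x hx => (hg_pos x hx).ne')
  refine ⟨max 1 (max A B), le_max_left _ _, fun x hx => ?_⟩
  have hC : 0 < max 1 (max A B) := lt_max_of_lt_left one_pos
  by_cases hxa : x = a
  · simp [hxa, ha]
  have hA' : g x ≤ max 1 (max A B) :=
    (le_abs_self _).trans ((hA x hx).trans (le_max_of_le_right (le_max_left _ _)))
  have hB' : (g x)⁻¹ ≤ max 1 (max A B) :=
    (le_abs_self _).trans ((hB x hx).trans (le_max_of_le_right (le_max_right _ _)))
  have hB'' := inv_le_of_inv_le₀ (hg_pos x hx) hB'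
  rw [hg_of_ne x hxa] at hA' hB''
  rw [one_div]
  exact ⟨(le_div_iff₀ (hsq x hxa)).mp hB'', (div_le_iff₀ (hsq x hxa)).mp hA'⟩

theorem Real.rpow_tangent_gap_self {γ r₀ : ℝ} (hr₀ : 0 < r₀) :
    r₀ ^ γ - γ * r₀ ^ (γ - 1) * r₀ + (γ - 1) * r₀ ^ γ = 0 := by
  have hpow : r₀ ^ γ = r₀ ^ (γ - 1) * r₀ := by
    rw [← Real.rpow_add_one hr₀.ne', sub_add_cancel]
  rw [hpow]
  ring

/-- The graph of `r ↦ r ^ γ` lies strictly above its tangent line at `r₀`. -/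
theorem Real.rpow_tangent_gap_pos {γ r₀ r : ℝ} (hγ : 1 < γ) (hr₀ : 0 < r₀) (hr : 0 ≤ r)
    (hne : r ≠ r₀) : 0 < r ^ γ - γ * r₀ ^ (γ - 1) * r + (γ - 1) * r₀ ^ γ := by
  have hbern := one_add_mul_self_lt_rpow_one_add (s := r / r₀ - 1)
    (by linarith [div_nonneg hr hr₀.le]) (by rwa [sub_ne_zero, ne_eq, div_eq_one_iff_eq hr₀.ne']) hγ
  rw [add_sub_cancel, Real.div_rpow hr hr₀.le, lt_div_iff₀ (Real.rpow_pos_of_pos hr₀ _)] at hbern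
  have hpow : r₀ ^ γ = r₀ ^ (γ - 1) * r₀ := by
    rw [← Real.rpow_add_one hr₀.ne', sub_add_cancel]
  have hexpand : (1 + γ * (r / r₀ - 1)) * r₀ ^ γ
      = γ * r₀ ^ (γ - 1) * r - (γ - 1) * r₀ ^ γ := by
    rw [hpow]
    field_simp
    ring
  linarith

open Filter Topology in
/-- Second-order Taylor quotient at `r₀` of the isentropic pressure potential. -/
theorem tendsto_isentropic_potential_div_sq {γ r₀ : ℝ} (hγ : 1 < γ) (hr₀ : 0 < r₀) :
    Tendsto (fun r : ℝ => (r ^ γ - γ * r₀ ^ (γ - 1) * r + (γ - 1) * r₀ ^ γ) / (γ - 1)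
      / (r - r₀) ^ 2) (𝓝[≠] r₀) (𝓝 (γ * r₀ ^ (γ - 2) / 2)) := by
  have hγ' : γ - 1 ≠ 0 := (sub_pos.mpr hγ).ne'
  have hderiv : ∀ r : ℝ, HasDerivAt
      (fun r : ℝ => (r ^ γ - γ * r₀ ^ (γ - 1) * r + (γ - 1) * r₀ ^ γ) / (γ - 1))
      ((γ * r ^ (γ - 1) - γ * r₀ ^ (γ - 1)) / (γ - 1)) r := fun r => by
    simpa using (((Real.hasDerivAt_rpow_const (Or.inr hγ.le)).sub
      ((hasDerivAt_id r).const_mul (γ * r₀ ^ (γ - 1)))).add_const _).div_const (γ - 1)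
  have hderiv_sq : ∀ r : ℝ, HasDerivAt (fun r : ℝ => (r - r₀) ^ 2) (2 * (r - r₀)) r :=
    fun r => by simpa using ((hasDerivAt_id r).sub_const r₀).fun_pow 2
  refine HasDerivAt.lhopital_zero_nhdsNE (.of_forall hderiv) (.of_forall hderiv_sq) ?_ ?_ ?_ ?_
  · filter_upwards [self_mem_nhdsWithin] with r hr
    exact mul_ne_zero two_ne_zero (sub_ne_zero.mpr hr)
  · have h := (hderiv r₀).continuousAt.tendsto
    have h0 : (r₀ ^ γ - γ * r₀ ^ (γ - 1) * r₀ + (γ - 1) * r₀ ^ γ) / (γ - 1) = 0 := by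
      rw [Real.rpow_tangent_gap_self hr₀, zero_div]
    rw [h0] at h
    exact h.mono_left nhdsWithin_le_nhds
  · have h := (hderiv_sq r₀).continuousAt.tendsto
    simp only [sub_self, ne_eq, OfNat.ofNat_ne_zero, not_false_eq_true, zero_pow] at h
    exact h.mono_left nhdsWithin_le_nhds
  · have h := (hasDerivAt_iff_tendsto_slope.mp
      (Real.hasDerivAt_rpow_const (p := γ - 1) (Or.inl hr₀.ne'))).const_mul (γ / (γ - 1) / 2)
    have hval : γ / (γ - 1) / 2 * ((γ - 1) * r₀ ^ (γ - 1 - 1)) = γ * r₀ ^ (γ - 2) / 2 := by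
      rw [show γ - 1 - 1 = γ - 2 by ring]
      field_simp
    rw [hval] at h
    refine h.congr' ?_
    filter_upwards [self_mem_nhdsWithin] with r hr
    have hr' : r - r₀ ≠ 0 := sub_ne_zero.mpr hr
    rw [slope_def_field]
    field_simp

/-- Lemma 2.2(1), isentropic case γ > 1, closed form: two-sided quadratic
bounds for (r^γ − γ r₀^{γ−1} r + (γ−1) r₀^γ)/(γ−1) on [0, rbar]. -/
theorem isentropic_potential_quadratic_bounds
    (γ r₀ rbar : ℝ) (hγ : 1 < γ) (hr₀ : 0 < r₀) (hrbar : 0 < rbar) :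
    ∃ C : ℝ, 1 ≤ C ∧ ∀ r ∈ Set.Icc (0 : ℝ) rbar,
      (1 / C) * (r - r₀) ^ 2
          ≤ (r ^ γ - γ * r₀ ^ (γ - 1) * r + (γ - 1) * r₀ ^ γ) / (γ - 1) ∧
      (r ^ γ - γ * r₀ ^ (γ - 1) * r + (γ - 1) * r₀ ^ γ) / (γ - 1)
          ≤ C * (r - r₀) ^ 2 := by
  have hγ' : 0 < γ - 1 := sub_pos.mpr hγ
  refine isCompact_Icc.exists_quadratic_bounds (a := r₀) (L := γ * r₀ ^ (γ - 2) / 2)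
    (f := fun r => (r ^ γ - γ * r₀ ^ (γ - 1) * r + (γ - 1) * r₀ ^ γ) / (γ - 1)) ?_ ?_ ?_
    (by positivity) (tendsto_isentropic_potential_div_sq hγ hr₀)
  · have := Real.continuous_rpow_const (q := γ) (by linarith)
    fun_prop
  · simp only [Real.rpow_tangent_gap_self hr₀, zero_div]
  · exact fun r hr hne => div_pos (Real.rpow_tangent_gap_pos hγ hr₀ hr.1 hne) hγ'
end

section
/- Let r₀ > 0 and r̄ > 0. Then there exists a constant C = C(r₀, r̄) ≥ 1 such that for all r ∈ [0, r̄]: (1/C)(r − r₀)² ≤ r ln(r/r₀) + r₀ − r ≤ C (r − r₀)², where the value of r ln(r/r₀) at r = 0 is taken to be 0. -/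
theorem Real.mul_log_add_one_sub_le_sq {x : ℝ} (hx : 0 ≤ x) :
    x * Real.log x + 1 - x ≤ (x - 1) ^ 2 := by
  rcases hx.eq_or_lt with rfl | hx
  · simp
  · nlinarith [mul_le_mul_of_nonneg_left (Real.log_le_sub_one_of_pos hx) hx.le]

theorem Real.sqrt_sub_one_sq_le_mul_log_add_one_sub {x : ℝ} (hx : 0 ≤ x) :
    (√x - 1) ^ 2 ≤ x * Real.log x + 1 - x := by
  rcases hx.eq_or_lt with rfl | hx
  · simp
  · have hs : 0 < √x := Real.sqrt_pos.2 hx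
    have hsq : √x ^ 2 = x := Real.sq_sqrt hx.le
    have hlog : 1 - (√x)⁻¹ ≤ Real.log x / 2 := by
      rw [← Real.log_sqrt hx.le]
      exact Real.one_sub_inv_le_log_of_pos hs
    have hinv : x * (√x)⁻¹ = √x := by
      rw [← div_eq_mul_inv, Real.div_sqrt]
    nlinarith [mul_le_mul_of_nonneg_left hlog hx.le]

theorem Real.sub_one_sq_le_mul_log_add_one_sub {x : ℝ} (hx : 0 ≤ x) :
    (x - 1) ^ 2 ≤ 2 * (x + 1) * (x * Real.log x + 1 - x) := by
  have hsq : √x ^ 2 = x := Real.sq_sqrt hx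
  calc (x - 1) ^ 2 = (√x + 1) ^ 2 * (√x - 1) ^ 2 := by
        rw [← mul_pow]
        congr 1
        linear_combination -hsq
    _ ≤ 2 * (x + 1) * (√x - 1) ^ 2 := by
        gcongr
        nlinarith [sq_nonneg (√x - 1)]
    _ ≤ 2 * (x + 1) * (x * Real.log x + 1 - x) := by
        gcongr
        exact Real.sqrt_sub_one_sq_le_mul_log_add_one_sub hx

/-- Lemma 2.2(1), isothermal case γ = 1, closed form: two-sided quadratic
bounds for r ln(r/r₀) + r₀ − r on [0, rbar] (with value r₀ at r = 0). -/
theorem isothermal_potential_quadratic_bounds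
    (r₀ rbar : ℝ) (hr₀ : 0 < r₀) (hrbar : 0 < rbar) :
    ∃ C : ℝ, 1 ≤ C ∧ ∀ r ∈ Set.Icc (0 : ℝ) rbar,
      (1 / C) * (r - r₀) ^ 2 ≤ r * Real.log (r / r₀) + r₀ - r ∧
      r * Real.log (r / r₀) + r₀ - r ≤ C * (r - r₀) ^ 2 := by
  have hinv : 0 < 1 / r₀ := by positivity
  refine ⟨1 + 1 / r₀ + 2 * (rbar + r₀), by linarith, ?_⟩
  rintro r ⟨hr, hr'⟩
  obtain ⟨x, rfl⟩ : ∃ x, r = r₀ * x := ⟨r / r₀, by field_simp⟩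
  have hx : 0 ≤ x := nonneg_of_mul_nonneg_right hr hr₀
  rw [mul_div_cancel_left₀ x hr₀.ne']
  have hfactor : r₀ * x * Real.log x + r₀ - r₀ * x = r₀ * (x * Real.log x + 1 - x) := by ring
  have hpot : 0 ≤ x * Real.log x + 1 - x :=
    (sq_nonneg _).trans (Real.sqrt_sub_one_sq_le_mul_log_add_one_sub hx)
  rw [hfactor]
  constructor
  · rw [one_div_mul_eq_div, div_le_iff₀' (by linarith)]
    calc (r₀ * x - r₀) ^ 2 = r₀ ^ 2 * (x - 1) ^ 2 := by ring
      _ ≤ r₀ ^ 2 * (2 * (x + 1) * (x * Real.log x + 1 - x)) := by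
          gcongr
          exact Real.sub_one_sq_le_mul_log_add_one_sub hx
      _ = 2 * (r₀ * x + r₀) * (r₀ * (x * Real.log x + 1 - x)) := by ring
      _ ≤ _ := by
          gcongr
          linarith
  · calc r₀ * (x * Real.log x + 1 - x) ≤ r₀ * (x - 1) ^ 2 := by
          gcongr
          exact Real.mul_log_add_one_sub_le_sq hx
      _ = 1 / r₀ * (r₀ * x - r₀) ^ 2 := by field_simp
      _ ≤ _ := by
          gcongr
          linarith
end
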